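/- arXiv:2112.10487 — 2 statements merged into one kernel-verified Lean document; each statement's English description precedes it below -/
import Mathlib

section
/- f divides d·q + y·d₁ − y·q·k, all four numbers l₁/b, r·x/d₁, −s·p/d and (d·q + y·d₁ − y·q·k)/f are integers, and the matrix A^{r,s} = [[l₁/b, r·x/d₁], [−s·p/d, (d·q + y·d₁ − y·q·k)/f]] has determinant 1; in other words A^{r,s} is an element of SL₂(ℤ). -/
/-- `f` divides `d·q + y·d₁ − y·q·k`, the four numbers `l₁/b`, `r·x/d₁`, `−s·p/d`
and `(d·q + y·d₁ − y·q·k)/f` are integers, and the matrix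
`A^{r,s} = [[l₁/b, r·x/d₁], [−s·p/d, (d·q + y·d₁ − y·q·k)/f]]` has determinant `1`,
i.e. `A^{r,s} ∈ SL₂(ℤ)`. -/
theorem Ars_mem_SL2 (k s r : ℕ) (hs : 1 ≤ s) (hsk : s < k) (hr : 1 ≤ r) (hrk : r < k)
    (d d₁ f l l₁ b a : ℕ)
    (hd : d = Nat.gcd s k) (hd₁ : d₁ = Nat.gcd r k) (hf : f = Nat.gcd d r)
    (hl : l = k / d) (hl₁ : l₁ = k / d₁) (hb : b = d / f) (ha : a = d₁ / f)
    (x y p q : ℤ) (hxy : s * x + k * y = d) (hpq : r * p + k * q = d₁) :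
    (f : ℤ) ∣ (d * q + y * d₁ - y * q * k) ∧
    (b : ℤ) ∣ (l₁ : ℤ) ∧ (d₁ : ℤ) ∣ (r : ℤ) * x ∧ (d : ℤ) ∣ (s : ℤ) * p ∧
    (!![(l₁ : ℤ) / b, (r : ℤ) * x / d₁;
        -((s : ℤ) * p) / d, ((d : ℤ) * q + y * d₁ - y * q * k) / f]).det = 1 := by
  have hk : 0 < k := by omega
  have hd0 : 0 < d := hd ▸ Nat.gcd_pos_of_pos_left k hs
  have hd₁0 : 0 < d₁ := hd₁ ▸ Nat.gcd_pos_of_pos_left k hr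
  have hf0 : 0 < f := hf ▸ Nat.gcd_pos_of_pos_left r hd0
  have hfgcd : f = Nat.gcd d d₁ := by
    rw [hf, hd₁, ← Nat.gcd_assoc]
    exact (Nat.gcd_eq_left ((Nat.gcd_dvd_left d r).trans (hd ▸ Nat.gcd_dvd_right s k))).symm
  have hfb : d = f * b := hb ▸ (Nat.mul_div_cancel' (hfgcd ▸ Nat.gcd_dvd_left d d₁)).symm
  have hfa : d₁ = f * a := ha ▸ (Nat.mul_div_cancel' (hfgcd ▸ Nat.gcd_dvd_right d d₁)).symm
  have hkl : k = d * l := hl ▸ (Nat.mul_div_cancel' (hd ▸ Nat.gcd_dvd_right s k)).symm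
  have hkl₁ : k = d₁ * l₁ := hl₁ ▸ (Nat.mul_div_cancel' (hd₁ ▸ Nat.gcd_dvd_right r k)).symm
  obtain ⟨s', hs'⟩ : d ∣ s := hd ▸ Nat.gcd_dvd_left s k
  obtain ⟨r', hr'⟩ : d₁ ∣ r := hd₁ ▸ Nat.gcd_dvd_left r k
  have hcop : Nat.Coprime b a := by
    rw [hb, ha, hfgcd]
    exact Nat.coprime_div_gcd_div_gcd (hfgcd ▸ hf0)
  have hbl : b * l = a * l₁ := by
    apply Nat.eq_of_mul_eq_mul_left hf0
    rw [← mul_assoc, ← mul_assoc, ← hfb, ← hfa, ← hkl, hkl₁]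
  obtain ⟨m, rfl⟩ : b ∣ l₁ := hcop.dvd_of_dvd_mul_left ⟨l, hbl.symm⟩
  have hb0 : 0 < b := Nat.pos_of_mul_pos_left (hfb ▸ hd0)
  have hlm : l = a * m := by
    apply Nat.eq_of_mul_eq_mul_left hb0
    rw [hbl]
    ring
  clear hd hd₁ hf hl hl₁ hb ha
  have hdz : (d : ℤ) ≠ 0 := by exact_mod_cast hd0.ne'
  have hd₁z : (d₁ : ℤ) ≠ 0 := by exact_mod_cast hd₁0.ne'
  have hfz : (f : ℤ) ≠ 0 := by exact_mod_cast hf0.ne'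
  have hbz : (b : ℤ) ≠ 0 := by exact_mod_cast hb0.ne'
  have hsx : (s' : ℤ) * x + a * m * y = 1 := by
    apply mul_left_cancel₀ hdz
    rw [hs', hkl, hlm] at hxy
    push_cast at hxy
    linear_combination hxy
  have hrp : (r' : ℤ) * p + b * m * q = 1 := by
    apply mul_left_cancel₀ hd₁z
    rw [hr', hkl₁] at hpq
    push_cast at hpq
    linear_combination hpq
  have hrx : (r : ℤ) * x = d₁ * (r' * x) := by
    rw [hr']
    push_cast
    ring
  have hsp : (s : ℤ) * p = d * (s' * p) := by
    rw [hs']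
    push_cast
    ring
  have hlast : (d : ℤ) * q + y * d₁ - y * q * k = f * (b * q + y * a - y * q * (a * b * m)) := by
    rw [hkl₁, hfb, hfa]
    push_cast
    ring
  refine ⟨⟨_, hlast⟩, ⟨m, by push_cast; ring⟩, ⟨_, hrx⟩, ⟨_, hsp⟩, ?_⟩
  rw [hlast, hrx, hsp, ← mul_neg, Nat.cast_mul, Int.mul_ediv_cancel_left _ hbz,
    Int.mul_ediv_cancel_left _ hd₁z, Int.mul_ediv_cancel_left _ hdz,
    Int.mul_ediv_cancel_left _ hfz, Matrix.det_fin_two_of]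
  linear_combination (r' * p : ℤ) * hsx + (1 - a * m * y : ℤ) * hrp
end

section
/- For every τ in the complex upper half-plane ℍ, the point w = (d·τ − r·x)/(f·l) lies in ℍ, the complex number d₁ − s·p·τ is nonzero, and the fractional linear action of A^{r,s} on w satisfies A^{r,s} · w = f·l₁·τ/(d₁ − s·p·τ); in particular f·l₁·τ/(d₁ − s·p·τ) lies in ℍ. -/
open UpperHalfPlane

/-- For every `τ` in the upper half-plane, the point `w = (d·τ − r·x)/(f·l)` lies in
the upper half-plane, `d₁ − s·p·τ ≠ 0`, and the fractional linear action of `A^{r,s}`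
on `w` satisfies `A^{r,s} • w = f·l₁·τ/(d₁ − s·p·τ)`; in particular
`f·l₁·τ/(d₁ − s·p·τ)` lies in the upper half-plane. -/
theorem Ars_moebius_action (k s r : ℕ) (hs : 1 ≤ s) (hsk : s < k) (hr : 1 ≤ r) (hrk : r < k)
    (d d₁ f l l₁ b a : ℕ)
    (hd : d = Nat.gcd s k) (hd₁ : d₁ = Nat.gcd r k) (hf : f = Nat.gcd d r)
    (hl : l = k / d) (hl₁ : l₁ = k / d₁) (hb : b = d / f) (ha : a = d₁ / f)
    (x y p q : ℤ) (hxy : s * x + k * y = d) (hpq : r * p + k * q = d₁)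
    (A : Matrix.SpecialLinearGroup (Fin 2) ℤ)
    (hA00 : (A : Matrix (Fin 2) (Fin 2) ℤ) 0 0 = (l₁ : ℤ) / b)
    (hA01 : (A : Matrix (Fin 2) (Fin 2) ℤ) 0 1 = (r : ℤ) * x / d₁)
    (hA10 : (A : Matrix (Fin 2) (Fin 2) ℤ) 1 0 = -((s : ℤ) * p) / d)
    (hA11 : (A : Matrix (Fin 2) (Fin 2) ℤ) 1 1 = ((d : ℤ) * q + y * d₁ - y * q * k) / f)
    (τ : UpperHalfPlane) :
    0 < ((((d : ℂ) * τ - (r : ℂ) * (x : ℂ)) / ((f : ℂ) * (l : ℂ)))).im ∧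
    ((d₁ : ℂ) - (s : ℂ) * (p : ℂ) * τ ≠ 0) ∧
    (∃ w : UpperHalfPlane,
      (w : ℂ) = ((d : ℂ) * τ - (r : ℂ) * (x : ℂ)) / ((f : ℂ) * (l : ℂ)) ∧
      ((A • w : UpperHalfPlane) : ℂ) =
        (f : ℂ) * (l₁ : ℂ) * τ / ((d₁ : ℂ) - (s : ℂ) * (p : ℂ) * τ)) ∧
    0 < ((f : ℂ) * (l₁ : ℂ) * τ / ((d₁ : ℂ) - (s : ℂ) * (p : ℂ) * τ)).im := by
  have hk0 : 0 < k := by omega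
  have hd0 : 0 < d := hd ▸ Nat.gcd_pos_of_pos_right _ hk0
  have hd₁0 : 0 < d₁ := hd₁ ▸ Nat.gcd_pos_of_pos_right _ hk0
  have hf' : f = Nat.gcd d d₁ := by
    rw [hf, hd₁, ← Nat.gcd_assoc, Nat.gcd_eq_left
      ((Nat.gcd_dvd_left d r).trans (hd ▸ Nat.gcd_dvd_right s k))]
  have hf0 : 0 < f := hf' ▸ Nat.gcd_pos_of_pos_left _ hd0
  have hab : Nat.Coprime b a := by
    rw [hb, ha, hf']
    exact Nat.coprime_div_gcd_div_gcd (hf' ▸ hf0)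
  have hdb : d = f * b := by rw [hb, Nat.mul_div_cancel' (hf' ▸ Nat.gcd_dvd_left _ _)]
  have hd₁a : d₁ = f * a := by rw [ha, Nat.mul_div_cancel' (hf' ▸ Nat.gcd_dvd_right _ _)]
  have hkl : k = d * l := by rw [hl, Nat.mul_div_cancel' (hd ▸ Nat.gcd_dvd_right _ _)]
  have hkl₁ : k = d₁ * l₁ := by rw [hl₁, Nat.mul_div_cancel' (hd₁ ▸ Nat.gcd_dvd_right _ _)]
  obtain ⟨s', hs'⟩ : d ∣ s := hd ▸ Nat.gcd_dvd_left _ _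
  obtain ⟨r', hr'⟩ : d₁ ∣ r := hd₁ ▸ Nat.gcd_dvd_left _ _
  clear hd hd₁ hf hf' hl hl₁ hb ha hs hsk hr hrk
  have hal : a * l₁ = b * l := by
    apply Nat.eq_of_mul_eq_mul_left hf0
    rw [← mul_assoc, ← mul_assoc, ← hdb, ← hd₁a, ← hkl, ← hkl₁]
  obtain ⟨m, hm⟩ : b ∣ l₁ := hab.dvd_of_dvd_mul_left ⟨l, hal⟩
  have hb0 : 0 < b := Nat.pos_of_ne_zero (by rintro rfl; simp at hdb; omega)
  have ha0 : 0 < a := Nat.pos_of_ne_zero (by rintro rfl; simp at hd₁a; omega)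
  have hlm : l = a * m := by
    apply Nat.eq_of_mul_eq_mul_left hb0
    rw [← hal, hm]; ring
  have hm0 : 0 < m := Nat.pos_of_ne_zero (by rintro rfl; simp at hlm; subst hlm; simp at hkl; omega)
  have hkm : k = f * b * (a * m) := by rw [hkl, hdb, hlm]
  clear hkl hkl₁ hal hab
  subst hlm hm hd₁a hdb hs' hr' hkm
  push_cast at *
  have hfZ : (f : ℤ) ≠ 0 := by positivity
  have haZ : (a : ℤ) ≠ 0 := by positivity
  have hbZ : (b : ℤ) ≠ 0 := by positivity
  have hxy' : (s' : ℤ) * x + a * m * y = 1 := by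
    apply mul_left_cancel₀ (mul_ne_zero hfZ hbZ); linear_combination hxy
  have hpq' : (r' : ℤ) * p + b * m * q = 1 := by
    apply mul_left_cancel₀ (mul_ne_zero hfZ haZ); linear_combination hpq
  replace hA00 : A.1 0 0 = m := by
    rw [hA00]; exact Int.mul_ediv_cancel_left _ hbZ
  replace hA01 : A.1 0 1 = r' * x := by
    rw [hA01, mul_assoc]; exact Int.mul_ediv_cancel_left _ (mul_ne_zero hfZ haZ)
  replace hA10 : A.1 1 0 = -(s' * p) := by
    rw [hA10, mul_assoc, ← mul_neg]; exact Int.mul_ediv_cancel_left _ (mul_ne_zero hfZ hbZ)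
  replace hA11 : A.1 1 1 = b * q + y * a - y * q * b * a * m := by
    rw [hA11]; apply Int.ediv_eq_of_eq_mul_right hfZ
    ring
  have hxyC : (s' : ℂ) * x + a * m * y = 1 := by exact_mod_cast hxy'
  have hpqC : (r' : ℂ) * p + b * m * q = 1 := by exact_mod_cast hpq'
  have hfC : (f : ℂ) ≠ 0 := by exact_mod_cast hfZ
  have haC : (a : ℂ) ≠ 0 := by exact_mod_cast haZ
  have hmC : (m : ℂ) ≠ 0 := by exact_mod_cast hm0.ne'
  have hw : (f * b * τ - f * a * r' * x : ℂ) / (f * (a * m)) =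
      ((b / (a * m) : ℝ) : ℂ) * τ + ((-(r' * x / m) : ℝ) : ℂ) := by
    push_cast; field_simp; ring
  have him : 0 < ((f * b * τ - f * a * r' * x : ℂ) / (f * (a * m))).im := by
    rw [hw, Complex.add_im, Complex.im_ofReal_mul, Complex.ofReal_im, add_zero]
    have := τ.im_pos
    positivity
  have hne : (f * a - f * b * s' * p * τ : ℂ) ≠ 0 := by
    intro h
    have hτ : ((f * a : ℝ) : ℂ) - ((f * b * s' * p : ℝ) : ℂ) * τ = 0 := by
      push_cast; exact h
    have hi := congrArg Complex.im hτ
    rw [Complex.sub_im, Complex.im_ofReal_mul, Complex.ofReal_im, Complex.zero_im, zero_sub,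
      neg_eq_zero, mul_eq_zero] at hi
    replace hi := hi.resolve_right τ.im_ne_zero
    rw [hi, Complex.ofReal_zero, zero_mul, sub_zero, Complex.ofReal_eq_zero] at hτ
    have : (0 : ℝ) < f * a := by positivity
    exact this.ne' hτ
  have hact : ((A • (⟨_, him⟩ : UpperHalfPlane) : UpperHalfPlane) : ℂ) =
      f * (b * m) * τ / (f * a - f * b * s' * p * τ) := by
    have hnum : (m : ℂ) * ((f * b * τ - f * a * r' * x) / (f * (a * m))) + r' * x =
        b * τ / a := by
      field_simp; ring
    have hden : (-(s' * p) : ℂ) * ((f * b * τ - f * a * r' * x) / (f * (a * m))) +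
        (b * q + y * a - y * q * b * a * m) =
        (f * a - f * b * s' * p * τ) / (f * (a * m)) := by
      field_simp
      linear_combination (a : ℂ) * r' * p * hxyC + a * (1 - a * m * y) * hpqC
    rw [UpperHalfPlane.specialLinearGroup_apply]
    simp only [algebraMap_int_eq, eq_intCast, hA00, hA01, hA10, hA11]
    push_cast
    rw [hnum, hden]
    field_simp
  exact ⟨him, hne, ⟨⟨_, him⟩, rfl, hact⟩, hact ▸ UpperHalfPlane.im_pos _⟩
end
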